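/- Let f : (0,∞) → ℂ be locally absolutely continuous, of bounded variation on (0,∞), with lim_{t→∞} f(t) = 0 (so that its derivative f' is Lebesgue integrable on (0,∞)). Then for every x > 0 the sine Fourier transform satisfies f̂_s(x) = ∫_0^∞ f(t) sin(xt) dt = (1/x) f(π/(2x)) + H_0(T_{f'})(x) + G(x), where T_{f'}(u) = f̂'_s(u)/u = (1/u)∫_0^∞ f'(t) sin(ut) dt, H_0 denotes the Hilbert transform of an odd function, and the function G satisfies ‖G‖_{L^1(0,∞)} ≤ C ‖f'‖_{L^1(0,∞)} for an absolute constant C > 0. -/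

import Mathlib

open MeasureTheory Filter Set Real

/-- The difference quotient `(exp (i s u) - exp (i x u)) / (s² - x²)`, extended analytically
across `s = x`. -/
noncomputable def expQuot (x u : ℝ) (s : ℂ) : ℂ :=
  dslope (fun z : ℂ => Complex.exp (Complex.I * z * u)) x s / (s + x)

theorem expQuot_of_ne {x u : ℝ} {s : ℂ} (hs : s ≠ x) :
    expQuot x u s = (Complex.exp (Complex.I * s * u) - Complex.exp (Complex.I * x * u)) /
      ((s - x) * (s + x)) := by
  rw [expQuot, dslope_of_ne _ hs, slope_def_field, div_div]

theorem differentiableOn_expQuot {x u : ℝ} :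
    DifferentiableOn ℂ (expQuot x u) {s : ℂ | -x < s.re} := by
  have hE : DifferentiableOn ℂ (fun z : ℂ => Complex.exp (Complex.I * z * u)) univ :=
    Differentiable.differentiableOn (by fun_prop)
  have h1 := ((Complex.differentiableOn_dslope (c := (x : ℂ)) univ_mem).2 hE).mono
    (subset_univ {s : ℂ | -x < s.re})
  refine h1.div (by fun_prop) fun s hs h0 => ?_
  have : s.re + x = 0 := by simpa using congrArg Complex.re h0
  simp only [mem_ofPred_eq] at hs
  linarith

theorem norm_expQuot_le {x u : ℝ} (hu : 0 ≤ u) {s : ℂ} (hs : s ≠ x) (him : 0 ≤ s.im) :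
    ‖expQuot x u s‖ ≤ 2 / (‖s - x‖ * ‖s + x‖) := by
  rw [expQuot_of_ne hs, norm_div, norm_mul]
  gcongr
  have h1 : ‖Complex.exp (Complex.I * s * u)‖ ≤ 1 := by
    rw [Complex.norm_exp]
    simp only [Complex.mul_re, Complex.I_re, Complex.I_im, Complex.ofReal_re, Complex.ofReal_im,
      Complex.mul_im]
    rw [Real.exp_le_one_iff]
    nlinarith [mul_nonneg him hu]
  have h2 : ‖Complex.exp (Complex.I * x * u)‖ ≤ 1 := by
    rw [Complex.norm_exp]
    simp
  linarith [norm_sub_le (Complex.exp (Complex.I * s * u)) (Complex.exp (Complex.I * x * u))]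

theorem integral_expQuot_rect {x u a b c : ℝ} (hx : 0 < x) (ha : 0 ≤ a) (hab : a ≤ b) :
    ∫ t in a..b, expQuot x u t =
      (∫ t in a..b, expQuot x u (t + c * Complex.I))
        - Complex.I * (∫ y in (0 : ℝ)..c, expQuot x u (b + y * Complex.I))
        + Complex.I * ∫ y in (0 : ℝ)..c, expQuot x u (a + y * Complex.I) := by
  have h := Complex.integral_boundary_rect_eq_zero_of_differentiableOn (expQuot x u)
    (a : ℂ) (b + c * Complex.I) (differentiableOn_expQuot.mono ?_)
  · simp only [Complex.ofReal_re, Complex.ofReal_im, Complex.add_re, Complex.mul_re,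
      Complex.I_re, Complex.I_im, Complex.add_im, Complex.mul_im, smul_eq_mul, mul_zero, mul_one,
      sub_zero, add_zero, zero_add, Complex.ofReal_zero, zero_mul] at h
    linear_combination h
  · intro s hs
    have := (Complex.mem_reProdIm.1 hs).1
    simp only [Complex.ofReal_re, Complex.add_re, Complex.mul_re, Complex.I_re, Complex.I_im,
      Complex.ofReal_im, mul_zero, mul_one, sub_zero, add_zero, uIcc_of_le hab] at this
    simp only [mem_ofPred_eq]
    linarith [this.1]

theorem norm_integral_expQuot_near {x u δ : ℝ} (hu : 0 ≤ u) (hδ : 0 < δ) (hδx : δ < x) :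
    ‖∫ t in (x - δ)..(x + δ), expQuot x u t‖ ≤ 8 / x := by
  have hx : 0 < x := hδ.trans hδx
  have key : ∀ s : ℂ, 0 ≤ s.re → 0 ≤ s.im → δ ≤ ‖s - x‖ → ‖expQuot x u s‖ ≤ 2 / (δ * x) := by
    intro s hre him hs
    have hne : s ≠ x := by
      rintro rfl
      simp at hs
      linarith
    refine (norm_expQuot_le hu hne him).trans ?_
    have : x ≤ ‖s + x‖ := by
      refine le_trans ?_ (Complex.re_le_norm _)
      simpa using hre
    gcongr
  rw [integral_expQuot_rect (c := δ) hx (by linarith) (by linarith)]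
  have hT : ‖∫ t in (x - δ)..(x + δ), expQuot x u (t + δ * Complex.I)‖
      ≤ 2 / (δ * x) * |(x + δ) - (x - δ)| := by
    refine intervalIntegral.norm_integral_le_of_norm_le_const fun t ht => ?_
    rw [uIoc_of_le (by linarith)] at ht
    refine key _ (by simp; linarith [ht.1]) (by simp [hδ.le]) ?_
    refine le_trans ?_ (Complex.abs_im_le_norm _)
    simp [abs_of_pos hδ]
  have hR : ‖∫ y in (0 : ℝ)..δ, expQuot x u ((x + δ : ℝ) + y * Complex.I)‖
      ≤ 2 / (δ * x) * |δ - 0| := by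
    refine intervalIntegral.norm_integral_le_of_norm_le_const fun t ht => ?_
    rw [uIoc_of_le hδ.le] at ht
    refine key _ (by simp; linarith) (by simp [ht.1.le]) ?_
    refine le_trans ?_ (Complex.abs_re_le_norm _)
    simp [abs_of_pos hδ]
  have hL : ‖∫ y in (0 : ℝ)..δ, expQuot x u ((x - δ : ℝ) + y * Complex.I)‖
      ≤ 2 / (δ * x) * |δ - 0| := by
    refine intervalIntegral.norm_integral_le_of_norm_le_const fun t ht => ?_
    rw [uIoc_of_le hδ.le] at ht
    refine key _ (by simp; linarith) (by simp [ht.1.le]) ?_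
    refine le_trans ?_ (Complex.abs_re_le_norm _)
    simp [abs_of_pos hδ]
  refine (norm_add_le _ _).trans ?_
  refine (add_le_add_left (norm_sub_le _ _) _).trans ?_
  rw [norm_mul, norm_mul, Complex.norm_I, one_mul, one_mul]
  have e : 2 / (δ * x) * |(x + δ) - (x - δ)| + 2 / (δ * x) * |δ - 0| + 2 / (δ * x) * |δ - 0|
      = 8 / x := by
    rw [show (x + δ) - (x - δ) = 2 * δ by ring, sub_zero, abs_of_pos hδ,
      abs_of_pos (by linarith : 0 < 2 * δ)]
    field_simp
    norm_num
  linarith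

/-- The Laplace transform of `1 / (y² + x²)`, evaluated at `u`. -/
noncomputable def laplaceKernel (x u : ℝ) : ℝ :=
  ∫ y in Ioi (0 : ℝ), Real.exp (-(y * u)) / (y ^ 2 + x ^ 2)

theorem integral_Ioi_one_div_sq_add_sq {x : ℝ} (hx : 0 < x) :
    IntegrableOn (fun y : ℝ => 1 / (y ^ 2 + x ^ 2)) (Ioi 0) ∧
      ∫ y in Ioi (0 : ℝ), 1 / (y ^ 2 + x ^ 2) = π / (2 * x) := by
  have hderiv : ∀ y ∈ Ici (0 : ℝ),
      HasDerivAt (fun y : ℝ => Real.arctan (y / x) / x) (1 / (y ^ 2 + x ^ 2)) y := by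
    intro y _
    have := ((Real.hasDerivAt_arctan (y / x)).comp y ((hasDerivAt_id y).div_const x)).div_const x
    refine this.congr_deriv ?_
    field_simp
    ring
  have hlim : Tendsto (fun y : ℝ => Real.arctan (y / x) / x) atTop (nhds (π / 2 / x)) :=
    (tendsto_nhds_of_tendsto_nhdsWithin (Real.tendsto_arctan_atTop.comp
      (tendsto_id.atTop_div_const hx))).div_const x
  refine ⟨integrableOn_Ioi_deriv_of_nonneg' hderiv (fun y _ => by positivity) hlim, ?_⟩
  rw [integral_Ioi_of_hasDerivAt_of_nonneg' hderiv (fun y _ => by positivity) hlim]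
  simp
  field_simp

theorem integrableOn_exp_div_sq_add_sq {x u : ℝ} (hx : 0 < x) (hu : 0 ≤ u) :
    IntegrableOn (fun y : ℝ => Real.exp (-(y * u)) / (y ^ 2 + x ^ 2)) (Ioi 0) := by
  refine (integral_Ioi_one_div_sq_add_sq hx).1.mono'
    (Measurable.aestronglyMeasurable (by fun_prop)) ?_
  filter_upwards [ae_restrict_mem measurableSet_Ioi] with y hy
  rw [Real.norm_of_nonneg (by positivity)]
  gcongr
  rw [Real.exp_le_one_iff]
  have := mul_nonneg (le_of_lt hy) hu
  linarith

theorem hasDerivAt_log_sub_log {x t : ℝ} (hx : 0 < x) (h1 : t - x ≠ 0) (h2 : t + x ≠ 0) :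
    HasDerivAt (fun t : ℝ => (Real.log (t - x) - Real.log (t + x)) / (2 * x))
      (1 / (t ^ 2 - x ^ 2)) t := by
  have := ((((hasDerivAt_id t).sub_const x).log h1).sub
    (((hasDerivAt_id t).add_const x).log h2)).div_const (2 * x)
  refine this.congr_deriv ?_
  have h3 : t ^ 2 - x ^ 2 ≠ 0 := by
    rw [show t ^ 2 - x ^ 2 = (t - x) * (t + x) by ring]
    exact mul_ne_zero h1 h2
  simp only [id]
  field_simp
  ring

theorem tendsto_log_sub_log_atTop (x : ℝ) :
    Tendsto (fun t : ℝ => (Real.log (t - x) - Real.log (t + x)) / (2 * x)) atTop (nhds 0) := by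
  have h1 : Tendsto (fun t : ℝ => 1 - (2 * x) / (t + x)) atTop (nhds (1 - 0)) :=
    tendsto_const_nhds.sub (tendsto_const_nhds.div_atTop (tendsto_atTop_add_const_right _ x
      tendsto_id))
  have h2 := ((Real.continuousAt_log (by norm_num : (1 - 0 : ℝ) ≠ 0)).tendsto.comp h1).div_const
    (2 * x)
  simp only [sub_zero, Real.log_one, zero_div] at h2
  refine h2.congr' ?_
  filter_upwards [eventually_gt_atTop |x|] with t ht
  have := abs_lt.1 ht
  simp only [Function.comp]
  rw [← Real.log_div (by linarith) (by linarith)]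
  congr 2
  have : t + x ≠ 0 := by linarith
  field_simp
  ring

theorem integral_Ioi_one_div_sq_sub_sq {x δ : ℝ} (hx : 0 < x) (hδ : 0 < δ) :
    IntegrableOn (fun t : ℝ => 1 / (t ^ 2 - x ^ 2)) (Ioi (x + δ)) ∧
      ∫ t in Ioi (x + δ), 1 / (t ^ 2 - x ^ 2) =
        -((Real.log δ - Real.log (2 * x + δ)) / (2 * x)) := by
  have hderiv : ∀ t ∈ Ici (x + δ), HasDerivAt
      (fun t : ℝ => (Real.log (t - x) - Real.log (t + x)) / (2 * x)) (1 / (t ^ 2 - x ^ 2)) t := by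
    intro t ht
    rw [mem_Ici] at ht
    exact hasDerivAt_log_sub_log hx (by linarith) (by linarith)
  have hpos : ∀ t ∈ Ioi (x + δ), 0 ≤ 1 / (t ^ 2 - x ^ 2) := by
    intro t ht
    rw [mem_Ioi] at ht
    have : 0 ≤ t ^ 2 - x ^ 2 := by nlinarith
    positivity
  refine ⟨integrableOn_Ioi_deriv_of_nonneg' hderiv hpos (tendsto_log_sub_log_atTop x), ?_⟩
  rw [integral_Ioi_of_hasDerivAt_of_nonneg' hderiv hpos (tendsto_log_sub_log_atTop x)]
  rw [show x + δ - x = δ by ring, show x + δ + x = 2 * x + δ by ring, zero_sub]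

theorem intervalIntegral_one_div_sq_sub_sq {x δ : ℝ} (hδ : 0 < δ) (hδx : δ < x) :
    IntervalIntegrable (fun t : ℝ => 1 / (t ^ 2 - x ^ 2)) volume 0 (x - δ) ∧
      ∫ t in (0 : ℝ)..(x - δ), 1 / (t ^ 2 - x ^ 2) =
        (Real.log δ - Real.log (2 * x - δ)) / (2 * x) := by
  have hx := hδ.trans hδx
  have hmem : ∀ t ∈ uIcc 0 (x - δ), 0 ≤ t ∧ t ≤ x - δ := by
    intro t ht
    rwa [uIcc_of_le (by linarith)] at ht
  have hint : IntervalIntegrable (fun t : ℝ => 1 / (t ^ 2 - x ^ 2)) volume 0 (x - δ) := by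
    refine ContinuousOn.intervalIntegrable (ContinuousOn.div (by fun_prop) (by fun_prop) ?_)
    intro t ht
    have := hmem t ht
    nlinarith
  refine ⟨hint, ?_⟩
  rw [intervalIntegral.integral_eq_sub_of_hasDerivAt (fun t ht => hasDerivAt_log_sub_log hx
    (by linarith [hmem t ht]) (by linarith [hmem t ht])) hint]
  rw [show x - δ - x = -δ by ring, show x - δ + x = 2 * x - δ by ring, zero_sub, zero_add,
    Real.log_neg_eq_log, Real.log_neg_eq_log]
  ring

theorem continuousOn_expQuot_ofReal {x u : ℝ} (hx : 0 < x) :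
    ContinuousOn (fun t : ℝ => expQuot x u t) (Ici 0) := by
  refine (differentiableOn_expQuot (x := x) (u := u)).continuousOn.comp
    Complex.continuous_ofReal.continuousOn ?_
  intro t ht
  rw [mem_Ici] at ht
  simp
  linarith

theorem integrableOn_expQuot {x u : ℝ} (hx : 0 < x) (hu : 0 ≤ u) :
    IntegrableOn (fun t : ℝ => expQuot x u t) (Ioi 0) := by
  have hcont := continuousOn_expQuot_ofReal (u := u) hx
  rw [← Ioc_union_Ioi_eq_Ioi (by linarith : (0 : ℝ) ≤ x + x)]
  refine IntegrableOn.union ?_ ?_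
  · exact ((hcont.mono Icc_subset_Ici_self).integrableOn_Icc).mono_set Ioc_subset_Icc_self
  · refine ((integral_Ioi_one_div_sq_sub_sq hx hx).1.const_mul 2).mono'
      ((hcont.mono ?_).aestronglyMeasurable measurableSet_Ioi) ?_
    · intro t ht
      rw [mem_Ioi] at ht
      rw [mem_Ici]
      linarith
    · filter_upwards [ae_restrict_mem measurableSet_Ioi] with t ht
      rw [mem_Ioi] at ht
      refine (norm_expQuot_le hu (by norm_cast; linarith) (by simp)).trans (le_of_eq ?_)
      rw [← norm_mul]
      norm_cast
      rw [Real.norm_of_nonneg (by nlinarith)]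
      ring

theorem expQuot_mul_I {x u y : ℝ} (hx : 0 < x) :
    expQuot x u (y * Complex.I) =
      Complex.exp (Complex.I * x * u) * ((1 / (y ^ 2 + x ^ 2) : ℝ) : ℂ) -
        ((Real.exp (-(y * u)) / (y ^ 2 + x ^ 2) : ℝ) : ℂ) := by
  have hne : (y * Complex.I : ℂ) ≠ x := by
    intro h
    have := congrArg Complex.re h
    simp at this
    linarith
  rw [expQuot_of_ne hne]
  have h1 : ((y : ℂ) * Complex.I - x) * (y * Complex.I + x) = -((y ^ 2 + x ^ 2 : ℝ) : ℂ) := by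
    push_cast
    linear_combination (y : ℂ) ^ 2 * Complex.I_sq
  have h2 : Complex.I * (y * Complex.I) * u = ((-(y * u) : ℝ) : ℂ) := by
    push_cast
    linear_combination (y : ℂ) * u * Complex.I_sq
  rw [h1, h2, Complex.ofReal_div, Complex.ofReal_div, Complex.ofReal_exp, Complex.ofReal_one]
  have h3 : ((y ^ 2 + x ^ 2 : ℝ) : ℂ) ≠ 0 := by
    norm_cast
    positivity
  field_simp
  ring

theorem integral_Ioi_expQuot {x u : ℝ} (hx : 0 < x) (hu : 0 ≤ u) :
    ∫ t in Ioi (0 : ℝ), expQuot x u t =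
      Complex.I * (Complex.exp (Complex.I * x * u) * ((π / (2 * x) : ℝ) : ℂ)
        - (laplaceKernel x u : ℂ)) := by
  have hvert : IntegrableOn (fun y : ℝ => expQuot x u (y * Complex.I)) (Ioi 0) ∧
      ∫ y in Ioi (0 : ℝ), expQuot x u (y * Complex.I) =
        Complex.exp (Complex.I * x * u) * ((π / (2 * x) : ℝ) : ℂ) - (laplaceKernel x u : ℂ) := by
    have i1 : IntegrableOn (fun y : ℝ => ((1 / (y ^ 2 + x ^ 2) : ℝ) : ℂ)) (Ioi 0) :=
      (integral_Ioi_one_div_sq_add_sq hx).1.ofReal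
    have i2 : IntegrableOn
        (fun y : ℝ => ((Real.exp (-(y * u)) / (y ^ 2 + x ^ 2) : ℝ) : ℂ)) (Ioi 0) :=
      (integrableOn_exp_div_sq_add_sq hx hu).ofReal
    simp only [expQuot_mul_I hx]
    refine ⟨(i1.const_mul _).sub i2, ?_⟩
    rw [integral_sub (i1.const_mul _) i2, integral_const_mul]
    congr 1
    · rw [← (integral_Ioi_one_div_sq_add_sq hx).2]
      congr 1
      exact integral_ofReal
    · exact integral_ofReal
  have hbound : ∀ R : ℝ, 2 * x < R → ∀ s : ℂ, 0 ≤ s.im → R ≤ ‖s‖ →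
      ‖expQuot x u s‖ ≤ 8 / R ^ 2 := by
    intro R hR s him hs
    have hxn : ‖(x : ℂ)‖ = x := by simp [hx.le]
    have h1 : R / 2 ≤ ‖s - x‖ := by
      have := norm_sub_norm_le s x
      linarith
    have h2 : R / 2 ≤ ‖s + x‖ := by
      have := norm_sub_le (s + x) x
      rw [add_sub_cancel_right] at this
      linarith
    have hne : s ≠ x := by
      rintro rfl
      linarith
    refine (norm_expQuot_le hu hne him).trans ?_
    have hRp : 0 < R := by linarith
    calc 2 / (‖s - x‖ * ‖s + x‖) ≤ 2 / (R / 2 * (R / 2)) := by gcongr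
      _ = 8 / R ^ 2 := by field_simp; norm_num
  have hzero : Tendsto (fun R : ℝ => 8 / R) atTop (nhds 0) :=
    tendsto_const_nhds.div_atTop tendsto_id
  have htop : Tendsto (fun R : ℝ => ∫ t in (0 : ℝ)..R, expQuot x u (t + R * Complex.I)) atTop
      (nhds 0) := by
    refine squeeze_zero_norm' ?_ hzero
    filter_upwards [eventually_gt_atTop (2 * x)] with R hR
    have hRp : 0 < R := by linarith
    refine (intervalIntegral.norm_integral_le_of_norm_le_const (C := 8 / R ^ 2)
      fun t ht => ?_).trans (le_of_eq ?_)
    · refine hbound R hR _ (by simp [hRp.le]) ?_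
      refine le_trans ?_ (Complex.abs_im_le_norm _)
      simp [le_abs_self]
    · rw [sub_zero, abs_of_pos hRp]
      field_simp
  have hright : Tendsto (fun R : ℝ => ∫ y in (0 : ℝ)..R, expQuot x u (R + y * Complex.I)) atTop
      (nhds 0) := by
    refine squeeze_zero_norm' ?_ hzero
    filter_upwards [eventually_gt_atTop (2 * x)] with R hR
    have hRp : 0 < R := by linarith
    refine (intervalIntegral.norm_integral_le_of_norm_le_const (C := 8 / R ^ 2)
      fun t ht => ?_).trans (le_of_eq ?_)
    · rw [uIoc_of_le hRp.le] at ht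
      refine hbound R hR _ (by simp [ht.1.le]) ?_
      refine le_trans ?_ (Complex.abs_re_le_norm _)
      simp [le_abs_self]
    · rw [sub_zero, abs_of_pos hRp]
      field_simp
  have hleft := intervalIntegral_tendsto_integral_Ioi 0 hvert.1 tendsto_id
  have hmain := intervalIntegral_tendsto_integral_Ioi 0 (integrableOn_expQuot hx hu) tendsto_id
  have hlim := (htop.sub (hright.const_mul Complex.I)).add (hleft.const_mul Complex.I)
  rw [hvert.2, mul_zero, sub_zero, zero_add] at hlim
  refine tendsto_nhds_unique (hmain.congr' ?_) hlim
  filter_upwards [eventually_ge_atTop 0] with R hR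
  rw [id, integral_expQuot_rect (c := R) hx le_rfl hR]
  simp

theorem setOf_pos_lt_abs_sub {x δ : ℝ} (hδ : 0 < δ) (hδx : δ < x) :
    {t : ℝ | 0 < t ∧ δ < |t - x|} = Ioo 0 (x - δ) ∪ Ioi (x + δ) := by
  ext t
  simp only [mem_ofPred_eq, mem_union, mem_Ioo, mem_Ioi, lt_abs]
  constructor
  · rintro ⟨h1, h2 | h2⟩
    · right; linarith
    · left; constructor <;> linarith
  · rintro (⟨h1, h2⟩ | h)
    · exact ⟨h1, Or.inr (by linarith)⟩
    · exact ⟨by linarith, Or.inl (by linarith)⟩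

theorem setIntegral_pos_lt_abs_sub {E : Type*} [NormedAddCommGroup E] [NormedSpace ℝ E]
    {x δ : ℝ} (hδ : 0 < δ) (hδx : δ < x) {g : ℝ → E}
    (h1 : IntegrableOn g (Ioc 0 (x - δ))) (h2 : IntegrableOn g (Ioi (x + δ))) :
    IntegrableOn g {t : ℝ | 0 < t ∧ δ < |t - x|} ∧
      ∫ t in {t : ℝ | 0 < t ∧ δ < |t - x|}, g t =
        (∫ t in (0 : ℝ)..(x - δ), g t) + ∫ t in Ioi (x + δ), g t := by
  rw [setOf_pos_lt_abs_sub hδ hδx]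
  have h1' := h1.mono_set Ioo_subset_Ioc_self
  refine ⟨h1'.union h2, ?_⟩
  rw [setIntegral_union _ measurableSet_Ioi h1' h2, intervalIntegral.integral_of_le (by linarith),
    integral_Ioc_eq_integral_Ioo]
  rw [Set.disjoint_left]
  rintro t ⟨_, ht⟩ ht'
  rw [mem_Ioi] at ht'
  linarith

theorem setIntegral_one_div_sq_sub_sq {x δ : ℝ} (hδ : 0 < δ) (hδx : δ < x) :
    IntegrableOn (fun t : ℝ => 1 / (t ^ 2 - x ^ 2)) {t : ℝ | 0 < t ∧ δ < |t - x|} ∧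
      ∫ t in {t : ℝ | 0 < t ∧ δ < |t - x|}, 1 / (t ^ 2 - x ^ 2) =
        (Real.log (2 * x + δ) - Real.log (2 * x - δ)) / (2 * x) := by
  have h1 := intervalIntegral_one_div_sq_sub_sq hδ hδx
  have h2 := integral_Ioi_one_div_sq_sub_sq (hδ.trans hδx) hδ
  have h3 := setIntegral_pos_lt_abs_sub hδ hδx
    ((intervalIntegrable_iff_integrableOn_Ioc_of_le (by linarith)).1 h1.1) h2.1
  refine ⟨h3.1, ?_⟩
  rw [h3.2, h1.2, h2.2]
  ring

theorem abs_setIntegral_one_div_sq_sub_sq_le {x δ : ℝ} (hδ : 0 < δ) (hδx : δ < x) :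
    |∫ t in {t : ℝ | 0 < t ∧ δ < |t - x|}, 1 / (t ^ 2 - x ^ 2)| ≤ 1 / x := by
  have hx := hδ.trans hδx
  rw [(setIntegral_one_div_sq_sub_sq hδ hδx).2, ← Real.log_div (by linarith) (by linarith),
    abs_of_nonneg]
  · have h1 : (2 * x + δ) / (2 * x - δ) ≤ 3 := by
      rw [div_le_iff₀ (by linarith)]
      linarith
    have h2 := Real.log_le_sub_one_of_pos
      (div_pos (by linarith : 0 < 2 * x + δ) (by linarith : 0 < 2 * x - δ))
    rw [div_le_div_iff₀ (by linarith) hx]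
    nlinarith
  · refine div_nonneg (Real.log_nonneg ?_) (by linarith)
    rw [le_div_iff₀ (by linarith)]
    linarith

theorem tendsto_setIntegral_one_div_sq_sub_sq {x : ℝ} (hx : 0 < x) :
    Tendsto (fun δ : ℝ => ∫ t in {t : ℝ | 0 < t ∧ δ < |t - x|}, 1 / (t ^ 2 - x ^ 2))
      (nhdsWithin 0 (Ioi 0)) (nhds 0) := by
  have h : ContinuousAt
      (fun δ : ℝ => (Real.log (2 * x + δ) - Real.log (2 * x - δ)) / (2 * x)) 0 := by
    have : 2 * x ≠ 0 := by positivity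
    refine ContinuousAt.div_const (ContinuousAt.sub (ContinuousAt.log (by fun_prop) (by simpa))
      (ContinuousAt.log (by fun_prop) (by simpa))) _
  have h' := h.tendsto
  simp only [add_zero, sub_zero, sub_self, zero_div] at h'
  refine (h'.mono_left nhdsWithin_le_nhds).congr' ?_
  filter_upwards [Ioo_mem_nhdsGT hx] with δ hδ
  rw [(setIntegral_one_div_sq_sub_sq hδ.1 hδ.2).2]

/-- The Hilbert-type integral of `t ↦ sin (t u)`, truncated at distance `δ` from the
singularity. -/
noncomputable def truncSinKernel (x δ u : ℝ) : ℝ :=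
  ∫ t in {t : ℝ | 0 < t ∧ δ < |t - x|}, Real.sin (t * u) / (t ^ 2 - x ^ 2)

theorem truncSinKernel_eq {x δ u : ℝ} (hδ : 0 < δ) (hδx : δ < x) (hu : 0 ≤ u) :
    truncSinKernel x δ u =
      π / (2 * x) * Real.cos (x * u) - laplaceKernel x u
        - (∫ t in (x - δ)..(x + δ), expQuot x u t).im
        + Real.sin (x * u) *
          ∫ t in {t : ℝ | 0 < t ∧ δ < |t - x|}, 1 / (t ^ 2 - x ^ 2) := by
  have hx := hδ.trans hδx
  have hq := integrableOn_expQuot hx hu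
  have hA := setIntegral_pos_lt_abs_sub hδ hδx (hq.mono_set Ioc_subset_Ioi_self)
    (hq.mono_set (Ioi_subset_Ioi (by linarith)))
  have hm : MeasurableSet {t : ℝ | 0 < t ∧ δ < |t - x|} := by
    rw [setOf_pos_lt_abs_sub hδ hδx]
    exact measurableSet_Ioo.union measurableSet_Ioi
  have hpt : ∀ t ∈ {t : ℝ | 0 < t ∧ δ < |t - x|}, Real.sin (t * u) / (t ^ 2 - x ^ 2) =
      (expQuot x u t).im + Real.sin (x * u) * (1 / (t ^ 2 - x ^ 2)) := by
    intro t ht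
    have hne : t ≠ x := by
      rintro rfl
      have := ht.2
      simp at this
      linarith
    rw [expQuot_of_ne (by exact_mod_cast hne)]
    have e1 : ((t : ℂ) - x) * (t + x) = ((t ^ 2 - x ^ 2 : ℝ) : ℂ) := by
      push_cast
      ring
    have e2 : ∀ y : ℝ, (Complex.exp (Complex.I * y * u)).im = Real.sin (y * u) := by
      intro y
      rw [show Complex.I * y * u = ((y * u : ℝ) : ℂ) * Complex.I by push_cast; ring,
        Complex.exp_ofReal_mul_I_im]
    rw [e1, Complex.div_ofReal_im, Complex.sub_im, e2, e2]
    ring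
  have hsplit : ∫ t in (0 : ℝ)..(x - δ), expQuot x u t =
      (∫ t in Ioi (0 : ℝ), expQuot x u t) - (∫ t in Ioi (x + δ), expQuot x u t)
        - ∫ t in (x - δ)..(x + δ), expQuot x u t := by
    have hq' := hq.mono_set (Ioi_subset_Ioi (by linarith : 0 ≤ x - δ))
    rw [← intervalIntegral.integral_interval_add_Ioi hq hq',
      ← intervalIntegral.integral_interval_add_Ioi hq'
        (hq.mono_set (Ioi_subset_Ioi (by linarith : 0 ≤ x + δ)))]
    ring
  have him : ∫ t in {t : ℝ | 0 < t ∧ δ < |t - x|}, (expQuot x u t).im =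
      (∫ t in {t : ℝ | 0 < t ∧ δ < |t - x|}, expQuot x u t).im := integral_im hA.1
  have himint : IntegrableOn (fun t : ℝ => (expQuot x u t).im)
      {t : ℝ | 0 < t ∧ δ < |t - x|} := hA.1.im
  rw [truncSinKernel, setIntegral_congr_fun hm hpt, integral_add himint
    ((setIntegral_one_div_sq_sub_sq hδ hδx).1.const_mul _), integral_const_mul, him, hA.2, hsplit,
    integral_Ioi_expQuot hx hu]
  have e3 : (Complex.exp (Complex.I * x * u)).re = Real.cos (x * u) := by
    rw [show Complex.I * x * u = ((x * u : ℝ) : ℂ) * Complex.I by push_cast; ring,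
      Complex.exp_ofReal_mul_I_re]
  simp only [Complex.add_im, Complex.sub_im, Complex.I_mul_im, Complex.sub_re,
    Complex.re_mul_ofReal, Complex.ofReal_re, e3]
  ring

theorem laplaceKernel_nonneg (x u : ℝ) : 0 ≤ laplaceKernel x u :=
  integral_nonneg fun y => by positivity

theorem laplaceKernel_le {x u : ℝ} (hx : 0 < x) (hu : 0 ≤ u) :
    laplaceKernel x u ≤ π / (2 * x) := by
  rw [← (integral_Ioi_one_div_sq_add_sq hx).2, laplaceKernel]
  refine setIntegral_mono_on (integrableOn_exp_div_sq_add_sq hx hu)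
    (integral_Ioi_one_div_sq_add_sq hx).1 measurableSet_Ioi fun y hy => ?_
  gcongr
  rw [Real.exp_le_one_iff]
  have := mul_nonneg (le_of_lt hy) hu
  linarith

theorem abs_truncSinKernel_le {x δ u : ℝ} (hδ : 0 < δ) (hδx : δ < x) (hu : 0 ≤ u) :
    |truncSinKernel x δ u| ≤ (π + 9) / x := by
  have hx := hδ.trans hδx
  rw [truncSinKernel_eq hδ hδx hu]
  have h1 : |π / (2 * x) * Real.cos (x * u)| ≤ π / (2 * x) := by
    rw [abs_mul, abs_of_pos (by positivity)]
    exact mul_le_of_le_one_right (by positivity) (Real.abs_cos_le_one _)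
  have h2 : |laplaceKernel x u| ≤ π / (2 * x) := by
    rw [abs_of_nonneg (laplaceKernel_nonneg x u)]
    exact laplaceKernel_le hx hu
  have h3 := (Complex.abs_im_le_norm _).trans (norm_integral_expQuot_near hu hδ hδx)
  have h4 : |Real.sin (x * u) * ∫ t in {t : ℝ | 0 < t ∧ δ < |t - x|}, 1 / (t ^ 2 - x ^ 2)|
      ≤ 1 / x := by
    rw [abs_mul]
    exact (mul_le_of_le_one_left (abs_nonneg _) (Real.abs_sin_le_one _)).trans
      (abs_setIntegral_one_div_sq_sub_sq_le hδ hδx)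
  refine (abs_add_le _ _).trans ((add_le_add ((abs_sub _ _).trans
    (add_le_add ((abs_sub _ _).trans (add_le_add h1 h2)) h3)) h4).trans (le_of_eq ?_))
  field_simp
  ring

theorem tendsto_truncSinKernel {x u : ℝ} (hx : 0 < x) (hu : 0 ≤ u) :
    Tendsto (fun δ : ℝ => truncSinKernel x δ u) (nhdsWithin 0 (Ioi 0))
      (nhds (π / (2 * x) * Real.cos (x * u) - laplaceKernel x u)) := by
  obtain ⟨M, hM⟩ := isCompact_Icc.exists_bound_of_continuousOn
    ((continuousOn_expQuot_ofReal (u := u) hx).mono (Icc_subset_Ici_self : Icc 0 (2 * x) ⊆ Ici 0))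
  have h1 : Tendsto (fun δ : ℝ => (∫ t in (x - δ)..(x + δ), expQuot x u t).im)
      (nhdsWithin 0 (Ioi 0)) (nhds 0) := by
    have h0 : Tendsto (fun δ : ℝ => M * (2 * δ)) (nhdsWithin 0 (Ioi 0)) (nhds 0) := by
      have : Tendsto (fun δ : ℝ => M * (2 * δ)) (nhds 0) (nhds (M * (2 * 0))) := by
        apply Continuous.tendsto
        fun_prop
      simpa using this.mono_left nhdsWithin_le_nhds
    refine squeeze_zero_norm' ?_ h0
    filter_upwards [Ioo_mem_nhdsGT hx] with δ hδ
    refine (Complex.abs_im_le_norm _).trans ?_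
    have := intervalIntegral.norm_integral_le_of_norm_le_const (a := x - δ) (b := x + δ) (C := M)
      (f := fun t : ℝ => expQuot x u t) fun t ht => hM t ?_
    · refine this.trans (le_of_eq ?_)
      rw [show x + δ - (x - δ) = 2 * δ by ring, abs_of_pos (by linarith [hδ.1])]
    · rw [uIoc_of_le (by linarith [hδ.1])] at ht
      exact ⟨by linarith [ht.1, hδ.2], by linarith [ht.2, hδ.2]⟩
  have h2 := (tendsto_setIntegral_one_div_sq_sub_sq hx).const_mul (Real.sin (x * u))
  have h3 := ((tendsto_const_nhds (x := π / (2 * x) * Real.cos (x * u) - laplaceKernel x u)).sub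
    h1).add h2
  rw [sub_zero, mul_zero, add_zero] at h3
  refine h3.congr' ?_
  filter_upwards [Ioo_mem_nhdsGT hx] with δ hδ
  rw [truncSinKernel_eq hδ.1 hδ.2 hu]

theorem setIntegral_sineTransform_div {x δ : ℝ} (hδ : 0 < δ) (hδx : δ < x) {g : ℝ → ℂ}
    (hg : IntegrableOn g (Ioi 0)) :
    IntegrableOn (fun u => g u * (truncSinKernel x δ u : ℂ)) (Ioi 0) ∧
      ∫ t in {t : ℝ | 0 < t ∧ δ < |t - x|},
        (t : ℂ) * ((∫ u in Ioi (0 : ℝ), g u * (Real.sin (t * u) : ℂ)) / (t : ℂ)) /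
          ((t : ℂ) ^ 2 - (x : ℂ) ^ 2) =
        ∫ u in Ioi (0 : ℝ), g u * (truncSinKernel x δ u : ℂ) := by
  have hm : MeasurableSet {t : ℝ | 0 < t ∧ δ < |t - x|} := by
    rw [setOf_pos_lt_abs_sub hδ hδx]
    exact measurableSet_Ioo.union measurableSet_Ioi
  have hq : IntegrableOn (fun t : ℝ => ((1 / (t ^ 2 - x ^ 2) : ℝ) : ℂ))
      {t : ℝ | 0 < t ∧ δ < |t - x|} := (setIntegral_one_div_sq_sub_sq hδ hδx).1.ofReal
  have hprod : Integrable (Function.uncurry fun t u : ℝ =>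
      g u * ((Real.sin (t * u) / (t ^ 2 - x ^ 2) : ℝ) : ℂ))
      ((volume.restrict {t : ℝ | 0 < t ∧ δ < |t - x|}).prod (volume.restrict (Ioi 0))) := by
    have h1 := (Integrable.mul_prod hq hg).bdd_mul (c := 1)
      (f := fun z : ℝ × ℝ => ((Real.sin (z.1 * z.2) : ℝ) : ℂ))
      (Continuous.aestronglyMeasurable (by fun_prop)) (Eventually.of_forall fun z => by
        rw [Complex.norm_real]
        exact Real.abs_sin_le_one _)
    refine h1.congr (Eventually.of_forall fun z => ?_)
    simp only [Function.uncurry]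
    push_cast
    ring
  have hK : ∀ u : ℝ, ∫ t in {t : ℝ | 0 < t ∧ δ < |t - x|},
      g u * ((Real.sin (t * u) / (t ^ 2 - x ^ 2) : ℝ) : ℂ) =
        g u * (truncSinKernel x δ u : ℂ) := by
    intro u
    rw [integral_const_mul]
    congr 1
    exact integral_ofReal
  constructor
  · have := hprod.integral_prod_right
    simp only [Function.uncurry, hK] at this
    exact this
  · rw [← integral_congr_ae (Eventually.of_forall hK), ← integral_integral_swap hprod]
    refine setIntegral_congr_fun hm fun t ht => ?_
    have ht0 : (t : ℂ) ≠ 0 := by exact_mod_cast ht.1.ne'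
    rw [mul_div_cancel₀ _ ht0, ← integral_div]
    refine integral_congr_ae (Eventually.of_forall fun u => ?_)
    push_cast
    ring

theorem tendsto_setIntegral_sineTransform_div {x : ℝ} (hx : 0 < x) {g : ℝ → ℂ}
    (hg : IntegrableOn g (Ioi 0)) :
    Tendsto (fun δ : ℝ => ∫ t in {t : ℝ | 0 < t ∧ δ < |t - x|},
        (t : ℂ) * ((∫ u in Ioi (0 : ℝ), g u * (Real.sin (t * u) : ℂ)) / (t : ℂ)) /
          ((t : ℂ) ^ 2 - (x : ℂ) ^ 2)) (nhdsWithin 0 (Ioi 0))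
      (nhds (∫ u in Ioi (0 : ℝ),
        g u * ((π / (2 * x) * Real.cos (x * u) - laplaceKernel x u : ℝ) : ℂ))) := by
  have hev : ∀ᶠ δ in nhdsWithin (0 : ℝ) (Ioi 0), δ ∈ Ioo 0 x := Ioo_mem_nhdsGT hx
  have h : Tendsto (fun δ : ℝ => ∫ u in Ioi (0 : ℝ), g u * (truncSinKernel x δ u : ℂ))
      (nhdsWithin 0 (Ioi 0)) (nhds (∫ u in Ioi (0 : ℝ),
        g u * ((π / (2 * x) * Real.cos (x * u) - laplaceKernel x u : ℝ) : ℂ))) := by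
    refine tendsto_integral_filter_of_dominated_convergence
      (fun u => ‖g u‖ * ((π + 9) / x)) ?_ ?_ (hg.norm.mul_const _) ?_
    · filter_upwards [hev] with δ hδ
      exact (setIntegral_sineTransform_div hδ.1 hδ.2 hg).1.aestronglyMeasurable
    · filter_upwards [hev] with δ hδ
      filter_upwards [ae_restrict_mem measurableSet_Ioi] with u hu
      rw [norm_mul, Complex.norm_real]
      gcongr
      exact abs_truncSinKernel_le hδ.1 hδ.2 (le_of_lt hu)
    · filter_upwards [ae_restrict_mem measurableSet_Ioi] with u hu
      exact ((Complex.continuous_ofReal.tendsto _).comp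
        (tendsto_truncSinKernel hx (le_of_lt hu))).const_mul _
  refine h.congr' ?_
  filter_upwards [hev] with δ hδ
  rw [(setIntegral_sineTransform_div hδ.1 hδ.2 hg).2]

theorem eq_neg_integral_Ioi {f g : ℝ → ℂ}
    (hf : ∀ a b : ℝ, 0 < a → a ≤ b → f b - f a = ∫ t in a..b, g t)
    (hlim : Tendsto f atTop (nhds 0)) (hg : IntegrableOn g (Ioi 0)) {t : ℝ} (ht : 0 < t) :
    f t = -∫ u in Ioi t, g u := by
  have h1 := intervalIntegral_tendsto_integral_Ioi t (hg.mono_set (Ioi_subset_Ioi ht.le))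
    tendsto_id
  have h2 : Tendsto (fun b => f b - f t) atTop (nhds (0 - f t)) := hlim.sub_const _
  have h3 := tendsto_nhds_unique (h2.congr' ?_) h1
  · rw [← h3]
    ring
  · filter_upwards [eventually_ge_atTop t] with b hb
    exact hf t b ht hb

theorem integral_sin_mul_zero {x : ℝ} (hx : 0 < x) (b : ℝ) :
    ∫ t in (0 : ℝ)..b, Real.sin (x * t) = (1 - Real.cos (x * b)) / x := by
  rw [intervalIntegral.integral_comp_mul_left (fun s => Real.sin s) hx.ne', integral_sin]
  simp
  ring

theorem intervalIntegral_mul_sin_eq {f g : ℝ → ℂ}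
    (hf : ∀ t, 0 < t → f t = -∫ u in Ioi t, g u) (hg : IntegrableOn g (Ioi 0))
    {x : ℝ} (hx : 0 < x) {N : ℝ} (hN : 0 < N) :
    ∫ t in (0 : ℝ)..N, f t * (Real.sin (x * t) : ℂ) =
      -∫ u in Ioi (0 : ℝ), g u * (((1 - Real.cos (x * min u N)) / x : ℝ) : ℂ) := by
  have hprod : Integrable (Function.uncurry fun t u : ℝ =>
      (Ioi t).indicator (fun u => g u * (Real.sin (x * t) : ℂ)) u)
      ((volume.restrict (Ioc 0 N)).prod (volume.restrict (Ioi 0))) := by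
    have hs : Integrable (fun t : ℝ => (Real.sin (x * t) : ℂ)) (volume.restrict (Ioc 0 N)) :=
      Continuous.integrableOn_Ioc (by fun_prop)
    have hset : MeasurableSet {z : ℝ × ℝ | z.1 < z.2} :=
      measurableSet_lt measurable_fst measurable_snd
    refine ((Integrable.mul_prod hs hg).indicator hset).congr (Eventually.of_forall fun z => ?_)
    simp only [Function.uncurry, indicator, mem_Ioi, mem_ofPred_eq]
    split_ifs
    · ring
    · rfl
  have hleft : ∫ t in (0 : ℝ)..N, f t * (Real.sin (x * t) : ℂ) =
      -∫ t in Ioc 0 N, ∫ u in Ioi (0 : ℝ),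
        (Ioi t).indicator (fun u => g u * (Real.sin (x * t) : ℂ)) u := by
    rw [intervalIntegral.integral_of_le hN.le, ← integral_neg]
    refine setIntegral_congr_fun measurableSet_Ioc fun t ht => ?_
    rw [setIntegral_indicator measurableSet_Ioi, Ioi_inter_Ioi, sup_of_le_right ht.1.le,
      integral_mul_const, hf t ht.1]
    ring
  rw [hleft, integral_integral_swap hprod]
  congr 1
  refine setIntegral_congr_fun measurableSet_Ioi fun u hu => ?_
  have hu' : 0 < u := hu
  have hind : ∀ t : ℝ, (Ioi t).indicator (fun u => g u * (Real.sin (x * t) : ℂ)) u =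
      (Iio u).indicator (fun t => g u * (Real.sin (x * t) : ℂ)) t := by
    intro t
    simp [indicator]
  simp only [hind]
  rw [setIntegral_indicator measurableSet_Iio, integral_const_mul,
    ← integral_sin_mul_zero hx (min u N)]
  congr 1
  rw [intervalIntegral.integral_of_le (le_min hu'.le hN.le), integral_complex_ofReal]
  congr 1
  refine setIntegral_congr_set ?_
  rcases le_or_gt u N with h | h
  · rw [min_eq_left h]
    have : Ioc 0 N ∩ Iio u = Ioo 0 u := by
      ext t
      simp only [mem_inter_iff, mem_Ioc, mem_Iio, mem_Ioo]
      exact ⟨fun h' => ⟨h'.1.1, h'.2⟩, fun h' => ⟨⟨h'.1, h'.2.le.trans h⟩, h'.2⟩⟩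
    rw [this]
    exact Ioo_ae_eq_Ioc
  · have : Ioc 0 N ⊆ Iio u := fun t ht => lt_of_le_of_lt ht.2 h
    rw [min_eq_right h.le, inter_eq_left.2 this]
    exact EventuallyEq.refl _ _

theorem tendsto_intervalIntegral_mul_sin {f g : ℝ → ℂ}
    (hf : ∀ t, 0 < t → f t = -∫ u in Ioi t, g u) (hg : IntegrableOn g (Ioi 0))
    {x : ℝ} (hx : 0 < x) :
    Tendsto (fun N : ℝ => ∫ t in (0 : ℝ)..N, f t * (Real.sin (x * t) : ℂ)) atTop
      (nhds (-∫ u in Ioi (0 : ℝ), g u * (((1 - Real.cos (x * u)) / x : ℝ) : ℂ))) := by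
  have h : Tendsto (fun N : ℝ => ∫ u in Ioi (0 : ℝ),
      g u * (((1 - Real.cos (x * min u N)) / x : ℝ) : ℂ)) atTop
      (nhds (∫ u in Ioi (0 : ℝ), g u * (((1 - Real.cos (x * u)) / x : ℝ) : ℂ))) := by
    refine tendsto_integral_filter_of_dominated_convergence
      (fun u => ‖g u‖ * (2 / x)) ?_ ?_ (hg.norm.mul_const _) ?_
    · refine Eventually.of_forall fun N => hg.aestronglyMeasurable.mul
        (Continuous.aestronglyMeasurable (by fun_prop))
    · refine Eventually.of_forall fun N => Eventually.of_forall fun u => ?_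
      rw [norm_mul, Complex.norm_real, Real.norm_of_nonneg
        (div_nonneg (by linarith [Real.cos_le_one (x * min u N)]) hx.le)]
      gcongr
      linarith [Real.neg_one_le_cos (x * min u N)]
    · refine Eventually.of_forall fun u => ?_
      refine tendsto_const_nhds.congr' ?_
      filter_upwards [eventually_ge_atTop u] with N hN
      rw [min_eq_left hN]
  refine h.neg.congr' ?_
  filter_upwards [eventually_gt_atTop 0] with N hN
  rw [intervalIntegral_mul_sin_eq hf hg hx hN]

theorem one_sub_exp_neg_le_sqrt {a : ℝ} (ha : 0 ≤ a) : 1 - Real.exp (-a) ≤ √a := by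
  rcases le_total a 1 with h | h
  · have h1 := Real.one_sub_le_exp_neg a
    have h2 : a ≤ √a := Real.le_sqrt_of_sq_le (by nlinarith)
    linarith
  · have h1 := Real.exp_pos (-a)
    have h2 : 1 ≤ √a := Real.one_le_sqrt.2 h
    linarith

theorem laplaceKernel_le_one_div {x u : ℝ} (hx : 0 < x) (hu : 0 < u) :
    laplaceKernel x u ≤ 1 / u * x ^ (-2 : ℝ) := by
  have hint := integrableOn_exp_mul_Ioi (neg_neg_of_pos hu) 0
  have h1 : ∫ y in Ioi (0 : ℝ), Real.exp (-u * y) / x ^ 2 = 1 / u * x ^ (-2 : ℝ) := by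
    rw [integral_div, integral_exp_mul_Ioi (neg_neg_of_pos hu),
      show (-2 : ℝ) = ((-2 : ℤ) : ℝ) by norm_num, Real.rpow_intCast]
    simp
    rfl
  rw [← h1, laplaceKernel]
  refine setIntegral_mono_on (integrableOn_exp_div_sq_add_sq hx hu.le) (hint.div_const _)
    measurableSet_Ioi fun y hy => ?_
  rw [show -(y * u) = -u * y by ring]
  gcongr
  nlinarith

theorem sub_laplaceKernel_le {x u : ℝ} (hx : 0 < x) (hu : 0 ≤ u) :
    π / (2 * x) - laplaceKernel x u ≤ 3 * √u * x ^ (-(1 / 2) : ℝ) := by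
  have i1 := (integral_Ioi_one_div_sq_add_sq hx).1
  have i2 := integrableOn_exp_div_sq_add_sq hx hu
  have i3 : IntegrableOn (fun y : ℝ => (1 - Real.exp (-(y * u))) / (y ^ 2 + x ^ 2)) (Ioi 0) := by
    refine (i1.sub i2).congr (Eventually.of_forall fun y => ?_)
    simp only [Pi.sub_apply]
    ring
  have hsqrt : x ^ (-(1 / 2) : ℝ) = √x / x := by
    rw [Real.rpow_neg hx.le, ← Real.sqrt_eq_rpow, inv_eq_one_div,
      div_eq_div_iff (by positivity) hx.ne', one_mul, Real.mul_self_sqrt hx.le]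
  have heq : π / (2 * x) - laplaceKernel x u =
      (∫ y in (0 : ℝ)..x, (1 - Real.exp (-(y * u))) / (y ^ 2 + x ^ 2)) +
        ∫ y in Ioi x, (1 - Real.exp (-(y * u))) / (y ^ 2 + x ^ 2) := by
    rw [intervalIntegral.integral_interval_add_Ioi i3 (i3.mono_set (Ioi_subset_Ioi hx.le)),
      ← (integral_Ioi_one_div_sq_add_sq hx).2, laplaceKernel, ← integral_sub i1 i2]
    congr 1
    ext y
    ring
  have hnear : ∫ y in (0 : ℝ)..x, (1 - Real.exp (-(y * u))) / (y ^ 2 + x ^ 2) ≤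
      √u * x ^ (-(1 / 2) : ℝ) := by
    refine (Real.le_norm_self _).trans ((intervalIntegral.norm_integral_le_of_norm_le_const
      (C := √x * √u / x ^ 2) fun y hy => ?_).trans (le_of_eq ?_))
    · rw [uIoc_of_le hx.le] at hy
      have hyu := mul_nonneg hy.1.le hu
      have h1 : 0 ≤ 1 - Real.exp (-(y * u)) := by
        linarith [Real.exp_le_one_iff.2 (neg_nonpos.2 hyu)]
      rw [Real.norm_of_nonneg (by positivity)]
      have h2 : 1 - Real.exp (-(y * u)) ≤ √x * √u := by
        refine (one_sub_exp_neg_le_sqrt hyu).trans ?_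
        rw [Real.sqrt_mul hy.1.le]
        gcongr
        exact hy.2
      gcongr
      nlinarith
    · rw [hsqrt, sub_zero, abs_of_pos hx]
      field_simp
  have hfar : ∫ y in Ioi x, (1 - Real.exp (-(y * u))) / (y ^ 2 + x ^ 2) ≤
      2 * √u * x ^ (-(1 / 2) : ℝ) := by
    have h32 : (-(3 / 2) : ℝ) < -1 := by norm_num
    have h1 : ∫ y in Ioi x, √u * y ^ (-(3 / 2) : ℝ) = 2 * √u * x ^ (-(1 / 2) : ℝ) := by
      rw [integral_const_mul, integral_Ioi_rpow_of_lt h32 hx,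
        show (-(3 / 2) + 1 : ℝ) = -(1 / 2) by norm_num]
      ring
    rw [← h1]
    refine setIntegral_mono_on (i3.mono_set (Ioi_subset_Ioi hx.le))
      ((integrableOn_Ioi_rpow_of_lt h32 hx).const_mul _) measurableSet_Ioi fun y hy => ?_
    have hy0 : 0 < y := hx.trans hy
    have h2 : y ^ (-(3 / 2) : ℝ) = √y / y ^ 2 := by
      rw [Real.sqrt_eq_rpow, ← Real.rpow_natCast, ← Real.rpow_sub hy0]
      norm_num
    rw [h2, ← mul_div_assoc]
    have h3 : 1 - Real.exp (-(y * u)) ≤ √u * √y := by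
      refine (one_sub_exp_neg_le_sqrt (mul_nonneg hy0.le hu)).trans ?_
      rw [mul_comm, Real.sqrt_mul hu]
    gcongr
    nlinarith
  rw [heq]
  linarith

/-- The kernel of the integrable remainder in the comparison of the sine Fourier transform with
the Hilbert transform. -/
noncomputable def remainderKernel (u x : ℝ) : ℝ :=
  -(1 / x) + (if π / (2 * x) < u then 1 / x else 0) + 2 / π * laplaceKernel x u

theorem measurable_uncurry_laplaceKernel : Measurable (Function.uncurry laplaceKernel) := by
  refine StronglyMeasurable.measurable (StronglyMeasurable.integral_prod_right
    (f := fun (p : ℝ × ℝ) (y : ℝ) => Real.exp (-(y * p.2)) / (y ^ 2 + p.1 ^ 2)) ?_)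
  refine Measurable.stronglyMeasurable ?_
  simp only [Function.uncurry_def]
  fun_prop

theorem measurable_uncurry_remainderKernel : Measurable (Function.uncurry remainderKernel) := by
  have h1 : Measurable fun p : ℝ × ℝ => laplaceKernel p.2 p.1 :=
    measurable_uncurry_laplaceKernel.comp measurable_swap
  have h2 : Measurable fun p : ℝ × ℝ => if π / (2 * p.2) < p.1 then 1 / p.2 else 0 :=
    Measurable.ite (measurableSet_lt (by fun_prop) (by fun_prop)) (by fun_prop) measurable_const
  have h3 : Measurable fun p : ℝ × ℝ => -(1 / p.2) := by fun_prop
  exact (h3.add h2).add (h1.const_mul _)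

theorem abs_remainderKernel_le_of_le {u x : ℝ} (hu : 0 < u) (hx : 0 < x)
    (h : x ≤ π / (2 * u)) :
    |remainderKernel u x| ≤ 6 / π * √u * x ^ (-(1 / 2) : ℝ) := by
  have hcond : ¬ π / (2 * x) < u := by
    rw [le_div_iff₀ (by positivity)] at h
    rw [not_lt, le_div_iff₀ (by positivity)]
    linarith
  have h1 : remainderKernel u x = -(2 / π * (π / (2 * x) - laplaceKernel x u)) := by
    rw [remainderKernel, if_neg hcond]
    field_simp
    ring
  have h2 : 0 ≤ π / (2 * x) - laplaceKernel x u := sub_nonneg.2 (laplaceKernel_le hx hu.le)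
  rw [h1, abs_neg, abs_of_nonneg (by positivity)]
  calc 2 / π * (π / (2 * x) - laplaceKernel x u)
      ≤ 2 / π * (3 * √u * x ^ (-(1 / 2) : ℝ)) := by
        gcongr
        exact sub_laplaceKernel_le hx hu.le
    _ = 6 / π * √u * x ^ (-(1 / 2) : ℝ) := by ring

theorem abs_remainderKernel_le_of_lt {u x : ℝ} (hu : 0 < u) (h : π / (2 * u) < x) :
    |remainderKernel u x| ≤ 2 / (π * u) * x ^ (-2 : ℝ) := by
  have hx : 0 < x := lt_trans (by positivity) h
  have hcond : π / (2 * x) < u := by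
    rw [div_lt_iff₀ (by positivity)] at h
    rw [div_lt_iff₀ (by positivity)]
    linarith
  have h1 : remainderKernel u x = 2 / π * laplaceKernel x u := by
    rw [remainderKernel, if_pos hcond]
    ring
  rw [h1, abs_of_nonneg (mul_nonneg (by positivity) (laplaceKernel_nonneg x u))]
  calc 2 / π * laplaceKernel x u ≤ 2 / π * (1 / u * x ^ (-2 : ℝ)) := by
        gcongr
        exact laplaceKernel_le_one_div hx hu
    _ = 2 / (π * u) * x ^ (-2 : ℝ) := by field_simp

theorem integral_abs_remainderKernel_le {u : ℝ} (hu : 0 < u) :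
    IntegrableOn (remainderKernel u) (Ioi 0) ∧
      ∫ x in Ioi (0 : ℝ), |remainderKernel u x| ≤ 12 / π * √(π / 2) + 4 / π ^ 2 := by
  set X : ℝ := π / (2 * u) with hX
  have hX0 : 0 < X := by positivity
  have hmeas : Measurable (remainderKernel u) :=
    measurable_uncurry_remainderKernel.comp measurable_prodMk_left
  have b1 : IntegrableOn (fun x : ℝ => 6 / π * √u * x ^ (-(1 / 2) : ℝ)) (Ioc 0 X) :=
    ((intervalIntegrable_iff_integrableOn_Ioc_of_le hX0.le).1
      (intervalIntegral.intervalIntegrable_rpow' (by norm_num))).const_mul _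
  have b2 : IntegrableOn (fun x : ℝ => 2 / (π * u) * x ^ (-2 : ℝ)) (Ioi X) :=
    (integrableOn_Ioi_rpow_of_lt (by norm_num) hX0).const_mul _
  have i1 : IntegrableOn (remainderKernel u) (Ioc 0 X) := by
    refine b1.mono' hmeas.aestronglyMeasurable ?_
    filter_upwards [ae_restrict_mem measurableSet_Ioc] with x hx
    exact abs_remainderKernel_le_of_le hu hx.1 hx.2
  have i2 : IntegrableOn (remainderKernel u) (Ioi X) := by
    refine b2.mono' hmeas.aestronglyMeasurable ?_
    filter_upwards [ae_restrict_mem measurableSet_Ioi] with x hx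
    exact abs_remainderKernel_le_of_lt hu hx
  have e1 : ∫ x in Ioc 0 X, 6 / π * √u * x ^ (-(1 / 2) : ℝ) = 12 / π * √(π / 2) := by
    rw [integral_const_mul, ← intervalIntegral.integral_of_le hX0.le,
      integral_rpow (Or.inl (by norm_num)), show (-(1 / 2) + 1 : ℝ) = 1 / 2 by norm_num,
      Real.zero_rpow (by norm_num), ← Real.sqrt_eq_rpow, sub_zero]
    have : √u * √X = √(π / 2) := by
      rw [← Real.sqrt_mul hu.le, hX]
      congr 1
      field_simp
    rw [← this]
    ring
  have e2 : ∫ x in Ioi X, 2 / (π * u) * x ^ (-2 : ℝ) = 4 / π ^ 2 := by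
    rw [integral_const_mul, integral_Ioi_rpow_of_lt (by norm_num) hX0,
      show (-2 + 1 : ℝ) = -1 by norm_num, Real.rpow_neg_one, hX]
    field_simp
    norm_num
  rw [← Ioc_union_Ioi_eq_Ioi hX0.le]
  refine ⟨i1.union i2, ?_⟩
  rw [setIntegral_union Ioc_disjoint_Ioi_same measurableSet_Ioi i1.abs i2.abs, ← e1, ← e2]
  exact add_le_add
    (setIntegral_mono_on i1.abs b1 measurableSet_Ioc fun x hx =>
      abs_remainderKernel_le_of_le hu hx.1 hx.2)
    (setIntegral_mono_on i2.abs b2 measurableSet_Ioi fun x hx =>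
      abs_remainderKernel_le_of_lt hu hx)

theorem integrable_integral_mul_remainderKernel {g : ℝ → ℂ} (hg : IntegrableOn g (Ioi 0)) :
    IntegrableOn (fun x => ∫ u in Ioi (0 : ℝ), g u * (remainderKernel u x : ℂ)) (Ioi 0) ∧
      ∫ x in Ioi (0 : ℝ), ‖∫ u in Ioi (0 : ℝ), g u * (remainderKernel u x : ℂ)‖ ≤
        (12 / π * √(π / 2) + 4 / π ^ 2) * ∫ u in Ioi (0 : ℝ), ‖g u‖ := by
  have hnorm : ∀ u x : ℝ, ‖g u * (remainderKernel u x : ℂ)‖ = ‖g u‖ * |remainderKernel u x| := by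
    intro u x
    rw [norm_mul, Complex.norm_real, Real.norm_eq_abs]
  have hmeas : AEStronglyMeasurable
      (Function.uncurry fun u x : ℝ => g u * (remainderKernel u x : ℂ))
      ((volume.restrict (Ioi 0)).prod (volume.restrict (Ioi 0))) :=
    (hg.aestronglyMeasurable.comp_fst).mul
      (Complex.measurable_ofReal.comp measurable_uncurry_remainderKernel).aestronglyMeasurable
  have hdom : ∀ᵐ u ∂volume.restrict (Ioi (0 : ℝ)),
      ∫ x in Ioi (0 : ℝ), ‖g u * (remainderKernel u x : ℂ)‖ ≤
        (12 / π * √(π / 2) + 4 / π ^ 2) * ‖g u‖ := by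
    filter_upwards [ae_restrict_mem measurableSet_Ioi] with u hu
    simp only [hnorm]
    rw [integral_const_mul, mul_comm]
    gcongr
    exact (integral_abs_remainderKernel_le hu).2
  have hint : Integrable (fun u => ∫ x in Ioi (0 : ℝ), ‖g u * (remainderKernel u x : ℂ)‖)
      (volume.restrict (Ioi 0)) := by
    refine (hg.norm.const_mul (12 / π * √(π / 2) + 4 / π ^ 2)).mono'
      hmeas.norm.integral_prod_right' ?_
    filter_upwards [hdom] with u hu
    rwa [Real.norm_of_nonneg (integral_nonneg fun x => norm_nonneg _)]
  have hprod : Integrable (Function.uncurry fun u x : ℝ => g u * (remainderKernel u x : ℂ))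
      ((volume.restrict (Ioi 0)).prod (volume.restrict (Ioi 0))) := by
    refine (integrable_prod_iff hmeas).2 ⟨?_, hint⟩
    filter_upwards [ae_restrict_mem measurableSet_Ioi] with u hu
    have hK : IntegrableOn (fun x : ℝ => (remainderKernel u x : ℂ)) (Ioi 0) :=
      (integral_abs_remainderKernel_le hu).1.ofReal
    exact hK.const_mul (g u)
  refine ⟨hprod.integral_prod_right, ?_⟩
  calc ∫ x in Ioi (0 : ℝ), ‖∫ u in Ioi (0 : ℝ), g u * (remainderKernel u x : ℂ)‖
      ≤ ∫ x in Ioi (0 : ℝ), ∫ u in Ioi (0 : ℝ), ‖g u * (remainderKernel u x : ℂ)‖ :=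
        integral_mono hprod.integral_prod_right.norm hprod.norm.integral_prod_right
          fun x => norm_integral_le_integral_norm _
    _ = ∫ u in Ioi (0 : ℝ), ∫ x in Ioi (0 : ℝ), ‖g u * (remainderKernel u x : ℂ)‖ :=
        (integral_integral_swap hprod.norm).symm
    _ ≤ ∫ u in Ioi (0 : ℝ), (12 / π * √(π / 2) + 4 / π ^ 2) * ‖g u‖ :=
        integral_mono_ae hint (hg.norm.const_mul _) hdom
    _ = _ := integral_const_mul _ _

/-- **Theorem 3.** If `f : (0,∞) → ℂ` is locally absolutely continuous (with derivative
`f'`), of bounded variation, and tends to `0` at infinity (so `f'` is integrable on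
`(0,∞)`), then for every `x > 0` the (improper) sine Fourier transform satisfies
`f̂_s(x) = (1/x) f(π/(2x)) + H₀(T_{f'})(x) + G(x)`, where `T_{f'}(u) = f̂'_s(u)/u`,
`H₀` is the Hilbert transform of an odd function, and
`‖G‖_{L¹(0,∞)} ≤ C ‖f'‖_{L¹(0,∞)}` for an absolute constant `C > 0`. -/
theorem sine_fourier_transform_eq_hilbert_of_T_plus_good :
    ∃ C : ℝ, 0 < C ∧
      ∀ (f f' fs H0T : ℝ → ℂ),
        -- local absolute continuity on (0,∞) with derivative f'
        (∀ a b : ℝ, 0 < a → a ≤ b → f b - f a = ∫ t in a..b, f' t) →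
        -- bounded variation on (0,∞)
        BoundedVariationOn f (Set.Ioi 0) →
        -- vanishing at infinity
        Filter.Tendsto f Filter.atTop (nhds 0) →
        -- f' is Lebesgue integrable on (0,∞)
        MeasureTheory.IntegrableOn f' (Set.Ioi 0) →
        -- fs is the (improper) sine Fourier transform of f
        (∀ x : ℝ, 0 < x →
          Filter.Tendsto (fun N : ℝ => ∫ t in (0 : ℝ)..N, f t * (Real.sin (x * t) : ℂ))
            Filter.atTop (nhds (fs x))) →
        -- H0T is the odd Hilbert transform (principal value) of T_{f'}(u) = f̂'_s(u)/u
        (∀ x : ℝ, 0 < x →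
          Filter.Tendsto (fun δ : ℝ =>
              ((2 / Real.pi : ℝ) : ℂ) *
                ∫ t in {t : ℝ | 0 < t ∧ δ < |t - x|},
                  (t : ℂ) *
                      ((∫ u in Set.Ioi (0 : ℝ), f' u * (Real.sin (t * u) : ℂ)) / (t : ℂ)) /
                    ((t : ℂ) ^ 2 - (x : ℂ) ^ 2))
            (nhdsWithin 0 (Set.Ioi 0)) (nhds (H0T x))) →
        ∃ G : ℝ → ℂ,
          (∀ x : ℝ, 0 < x →
            fs x = ((1 / x : ℝ) : ℂ) * f (Real.pi / (2 * x)) + H0T x + G x) ∧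
          MeasureTheory.IntegrableOn G (Set.Ioi 0) ∧
          (∫ x in Set.Ioi (0 : ℝ), ‖G x‖) ≤ C * ∫ t in Set.Ioi (0 : ℝ), ‖f' t‖ := by
  refine ⟨12 / π * √(π / 2) + 4 / π ^ 2, by positivity, ?_⟩
  intro f f' fs H0T hf _ hlim hg hfs hH
  have hrep : ∀ t, 0 < t → f t = -∫ u in Ioi t, f' u := fun t ht =>
    eq_neg_integral_Ioi hf hlim hg ht
  refine ⟨fun x => ∫ u in Ioi (0 : ℝ), f' u * (remainderKernel u x : ℂ), fun x hx => ?_,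
    integrable_integral_mul_remainderKernel hg⟩
  have e1 := tendsto_nhds_unique (hfs x hx) (tendsto_intervalIntegral_mul_sin hrep hg hx)
  have e2 := tendsto_nhds_unique (hH x hx)
    ((tendsto_setIntegral_sineTransform_div hx hg).const_mul ((2 / π : ℝ) : ℂ))
  have hX : 0 < π / (2 * x) := by positivity
  have e3 : ((1 / x : ℝ) : ℂ) * f (π / (2 * x)) =
      -∫ u in Ioi (0 : ℝ), f' u * ((if π / (2 * x) < u then 1 / x else 0 : ℝ) : ℂ) := by
    have : ∀ u, f' u * ((if π / (2 * x) < u then 1 / x else 0 : ℝ) : ℂ) =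
        (Ioi (π / (2 * x))).indicator (fun u => f' u * ((1 / x : ℝ) : ℂ)) u := by
      intro u
      simp only [indicator, mem_Ioi]
      split_ifs <;> simp
    simp only [this]
    rw [setIntegral_indicator measurableSet_Ioi, Ioi_inter_Ioi, sup_of_le_right hX.le,
      integral_mul_const, hrep _ hX]
    ring
  have hbdd : ∀ (k : ℝ → ℝ) (c : ℝ), Measurable k → (∀ u, 0 < u → |k u| ≤ c) →
      IntegrableOn (fun u => f' u * (k u : ℂ)) (Ioi 0) := by
    intro k c hk hc
    refine Integrable.mul_bdd (c := c) hg
      (Complex.measurable_ofReal.comp hk).aestronglyMeasurable ?_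
    filter_upwards [ae_restrict_mem measurableSet_Ioi] with u hu
    rw [Complex.norm_real]
    exact hc u hu
  have ia := hbdd (fun u => (1 - Real.cos (x * u)) / x) (2 / x) (by fun_prop) fun u _ => by
    rw [abs_of_nonneg (div_nonneg (by linarith [Real.cos_le_one (x * u)]) hx.le)]
    gcongr
    linarith [Real.neg_one_le_cos (x * u)]
  have ib := hbdd (fun u => if π / (2 * x) < u then 1 / x else 0) (1 / x)
    (Measurable.ite measurableSet_Ioi measurable_const measurable_const) fun u _ => by
      split_ifs
      · rw [abs_of_pos (by positivity)]
      · rw [abs_zero]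
        positivity
  have ic := hbdd (fun u => π / (2 * x) * Real.cos (x * u) - laplaceKernel x u)
    (π / (2 * x) + π / (2 * x))
    (Measurable.sub (by fun_prop)
      (measurable_uncurry_laplaceKernel.comp measurable_prodMk_left)) fun u hu => by
      refine (abs_sub _ _).trans (add_le_add ?_ ?_)
      · rw [abs_mul, abs_of_pos hX]
        exact mul_le_of_le_one_right hX.le (Real.abs_cos_le_one _)
      · rw [abs_of_nonneg (laplaceKernel_nonneg x u)]
        exact laplaceKernel_le hx hu.le
  have hsum : ∫ u in Ioi (0 : ℝ), f' u * (remainderKernel u x : ℂ) =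
      ∫ u in Ioi (0 : ℝ), (f' u * ((if π / (2 * x) < u then 1 / x else 0 : ℝ) : ℂ)
        - f' u * (((1 - Real.cos (x * u)) / x : ℝ) : ℂ))
        - ((2 / π : ℝ) : ℂ) *
          (f' u * ((π / (2 * x) * Real.cos (x * u) - laplaceKernel x u : ℝ) : ℂ)) := by
    refine integral_congr_ae (Eventually.of_forall fun u => ?_)
    have hk : remainderKernel u x = (if π / (2 * x) < u then 1 / x else 0)
        - (1 - Real.cos (x * u)) / x
        - 2 / π * (π / (2 * x) * Real.cos (x * u) - laplaceKernel x u) := by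
      rw [remainderKernel]
      field_simp
      ring
    simp only [hk, Complex.ofReal_sub, Complex.ofReal_mul]
    ring
  have hba : IntegrableOn (fun u => f' u * ((if π / (2 * x) < u then 1 / x else 0 : ℝ) : ℂ)
      - f' u * (((1 - Real.cos (x * u)) / x : ℝ) : ℂ)) (Ioi 0) := ib.sub ia
  rw [integral_sub hba (ic.const_mul _), integral_sub ib ia, integral_const_mul] at hsum
  simp only [e1, e2, e3, hsum]
  ring
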